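/- Let a > 0, b > 0 and let s, ν be real numbers with 0 < s < 2ν. Then the Mellin transform ∫₀^∞ x^{s−1} / [(x+a)(x+b)]^ν dx equals (2/(a+b))^{2ν−s} · B(s, 2ν−s) · ₂F₁(ν − s/2, ν − (s−1)/2; ν + 1/2; ((a−b)/(a+b))²); note that |(a−b)/(a+b)| < 1, so the ₂F₁ series converges. -/

import Mathlib

open MeasureTheory Set

/-- Pochhammer symbol `(c)_n = c(c+1)⋯(c+n−1)` for a real `c`. -/
noncomputable def poch (c : ℝ) (n : ℕ) : ℝ := ∏ i ∈ Finset.range n, (c + i)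

/-- The Gauss hypergeometric series `₂F₁(a,b;c;z)`. -/
noncomputable def hyp2F1 (a b c z : ℝ) : ℝ :=
  ∑' n : ℕ, poch a n * poch b n / poch c n * z ^ n / n.factorial

/-- The Beta function `B(x,y) = Γ(x)Γ(y)/Γ(x+y)`. -/
noncomputable def betaFn (x y : ℝ) : ℝ := Real.Gamma x * Real.Gamma y / Real.Gamma (x + y)

theorem poch_succ (c : ℝ) (n : ℕ) : poch c (n + 1) = poch c n * (c + n) :=
  Finset.prod_range_succ _ _

theorem poch_pos {c : ℝ} (hc : 0 < c) (n : ℕ) : 0 < poch c n :=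
  Finset.prod_pos fun _ _ ↦ by positivity

theorem ascPochhammer_smeval_eq_poch (c : ℝ) (n : ℕ) :
    (ascPochhammer ℕ n).smeval c = poch c n := by
  rw [Polynomial.ascPochhammer_smeval_eq_eval]
  induction n with
  | zero => simp [poch]
  | succ n ih => rw [ascPochhammer_succ_eval, ih, poch_succ]

theorem choose_add_sub_one_eq_poch_div_factorial (c : ℝ) (n : ℕ) :
    Ring.choose (c + n - 1) n = poch c n / n.factorial := by
  have h := Ring.factorial_nsmul_multichoose_eq_ascPochhammer c n
  rw [Ring.multichoose_eq, nsmul_eq_mul, ascPochhammer_smeval_eq_poch] at h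
  rw [eq_div_iff (by positivity), ← h, mul_comm]

/-- The negative binomial series. -/
theorem hasSum_poch_div_factorial_mul_pow (c : ℝ) {z : ℝ} (hz : |z| < 1) :
    HasSum (fun n : ℕ ↦ poch c n / n.factorial * z ^ n) ((1 - z) ^ (-c)) := by
  have h := (Real.one_div_one_sub_rpow_hasFPowerSeriesOnBall_zero c).hasSum (y := z)
    (by rw [← ENNReal.ofReal_one, Metric.eball_ofReal]; simpa using hz)
  have h1 : 0 ≤ 1 - z := by linarith [(abs_lt.1 hz).2]
  simpa [choose_add_sub_one_eq_poch_div_factorial, Real.rpow_neg h1, mul_comm] using h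

/-- Iterated duplication: `Γ(x + 2n)` in terms of `Γ(x)`. -/
theorem Gamma_add_two_mul_nat {x : ℝ} (hx : 0 < x) (n : ℕ) :
    Real.Gamma (x + 2 * n) = 4 ^ n * poch (x / 2) n * poch (x / 2 + 1 / 2) n * Real.Gamma x := by
  induction n with
  | zero => simp [poch]
  | succ n ih =>
    have h : x + 2 * ((n + 1 : ℕ) : ℝ) = x + 2 * n + 1 + 1 := by push_cast; ring
    rw [h, Real.Gamma_add_one (by positivity), Real.Gamma_add_one (by positivity), ih,
      poch_succ, poch_succ]
    ring

theorem lintegral_rpow_mul_exp_neg_mul_Ioi {a r : ℝ} (ha : 0 < a) (hr : 0 < r) :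
    ∫⁻ t in Ioi (0 : ℝ), ENNReal.ofReal (t ^ (a - 1) * Real.exp (-(r * t))) =
      ENNReal.ofReal ((1 / r) ^ a * Real.Gamma a) := by
  have key := Real.integral_rpow_mul_exp_neg_mul_Ioi ha hr
  have hG := Real.Gamma_pos_of_pos ha
  rw [← key, ofReal_integral_eq_lintegral_ofReal]
  · exact .of_integral_ne_zero (by rw [key]; positivity)
  · filter_upwards [ae_restrict_mem measurableSet_Ioi] with t ht
    have : 0 < t := ht
    simp only [Pi.zero_apply]
    positivity

/-- The Beta integral on the half-line. -/
theorem lintegral_rpow_mul_add_rpow_neg {s p m : ℝ} (hs : 0 < s) (hsp : s < p) (hm : 0 < m) :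
    ∫⁻ x in Ioi (0 : ℝ), ENNReal.ofReal (x ^ (s - 1) * (x + m) ^ (-p)) =
      ENNReal.ofReal (Real.Gamma s * Real.Gamma (p - s) / Real.Gamma p * m ^ (s - p)) := by
  have hp : 0 < p := hs.trans hsp
  have hGp := Real.Gamma_pos_of_pos hp
  have hGs := Real.Gamma_pos_of_pos hs
  have hx (x : ℝ) (hx0 : x ∈ Ioi (0 : ℝ)) :
      ENNReal.ofReal (Real.Gamma p) * ENNReal.ofReal (x ^ (s - 1) * (x + m) ^ (-p)) =
        ∫⁻ t in Ioi (0 : ℝ), ENNReal.ofReal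
          (x ^ (s - 1) * (t ^ (p - 1) * Real.exp (-((x + m) * t)))) := by
    have hx0 : 0 < x := hx0
    simp_rw [ENNReal.ofReal_mul (Real.rpow_nonneg hx0.le (s - 1))]
    rw [lintegral_const_mul' _ _ ENNReal.ofReal_ne_top,
      lintegral_rpow_mul_exp_neg_mul_Ioi hp (by positivity), mul_left_comm,
      ← ENNReal.ofReal_mul hGp.le, one_div, Real.inv_rpow (by positivity),
      ← Real.rpow_neg (by positivity), mul_comm (Real.Gamma p)]
  have ht (t : ℝ) (ht0 : t ∈ Ioi (0 : ℝ)) :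
      ∫⁻ x in Ioi (0 : ℝ), ENNReal.ofReal
          (x ^ (s - 1) * (t ^ (p - 1) * Real.exp (-((x + m) * t)))) =
        ENNReal.ofReal (Real.Gamma s) *
          ENNReal.ofReal (t ^ (p - s - 1) * Real.exp (-(m * t))) := by
    have ht0 : 0 < t := ht0
    have h (x : ℝ) : x ^ (s - 1) * (t ^ (p - 1) * Real.exp (-((x + m) * t))) =
        t ^ (p - 1) * Real.exp (-(m * t)) * (x ^ (s - 1) * Real.exp (-(t * x))) := by
      rw [show -((x + m) * t) = -(m * t) + -(t * x) by ring, Real.exp_add]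
      ring
    have h0 : 0 ≤ t ^ (p - 1) * Real.exp (-(m * t)) := by positivity
    simp_rw [h, ENNReal.ofReal_mul h0]
    rw [lintegral_const_mul' _ _ ENNReal.ofReal_ne_top, lintegral_rpow_mul_exp_neg_mul_Ioi hs ht0,
      ← ENNReal.ofReal_mul h0, ← ENNReal.ofReal_mul hGs.le, one_div, Real.inv_rpow ht0.le,
      ← Real.rpow_neg ht0.le, show p - s - 1 = p - 1 + -s by ring, Real.rpow_add ht0]
    congr 1
    ring
  have hne : ENNReal.ofReal (Real.Gamma p) ≠ 0 := by simpa using hGp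
  rw [← ENNReal.mul_right_inj hne ENNReal.ofReal_ne_top,
    ← lintegral_const_mul' _ _ ENNReal.ofReal_ne_top, setLIntegral_congr_fun measurableSet_Ioi hx,
    lintegral_lintegral_swap (by fun_prop), setLIntegral_congr_fun measurableSet_Ioi ht,
    lintegral_const_mul' _ _ ENNReal.ofReal_ne_top,
    lintegral_rpow_mul_exp_neg_mul_Ioi (sub_pos.2 hsp) hm, ← ENNReal.ofReal_mul hGs.le,
    ← ENNReal.ofReal_mul hGp.le, one_div, Real.inv_rpow hm.le, ← Real.rpow_neg hm.le, neg_sub]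
  congr 1
  field_simp

/-- Expansion of `((x+a)(x+b))^{-ν}` in inverse powers of `x + (a+b)/2`. -/
theorem hasSum_mul_add_rpow_neg {a b x : ℝ} (ha : 0 < a) (hb : 0 < b) (hx : 0 < x) (ν : ℝ) :
    HasSum (fun n : ℕ ↦ poch ν n / n.factorial * (((a - b) / 2) ^ 2) ^ n *
      (x + (a + b) / 2) ^ (-(2 * ν + 2 * n))) (((x + a) * (x + b)) ^ (-ν)) := by
  set y := x + (a + b) / 2 with hy
  have hy0 : 0 < y := by positivity
  set d := (a - b) / 2 with hd
  have hprod : (x + a) * (x + b) = y ^ 2 * (1 - d ^ 2 / y ^ 2) := by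
    field_simp
    rw [hy, hd]
    ring
  have hz : d ^ 2 / y ^ 2 < 1 := by
    rw [div_lt_one (by positivity)]
    have : 0 < (x + a) * (x + b) := by positivity
    rw [hy, hd]
    nlinarith
  have hz0 : 0 ≤ d ^ 2 / y ^ 2 := by positivity
  have h := (hasSum_poch_div_factorial_mul_pow ν (abs_lt.2 ⟨by linarith, hz⟩)).mul_left
    ((y ^ 2) ^ (-ν))
  rw [← Real.mul_rpow (by positivity) (by linarith), ← hprod] at h
  refine h.congr_fun fun n ↦ ?_
  have e : y ^ (-(2 * ν + 2 * n)) = (y ^ 2) ^ (-ν) * ((y ^ 2) ^ n)⁻¹ := by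
    rw [← Real.rpow_natCast y 2, ← Real.rpow_natCast _ n, ← Real.rpow_mul hy0.le,
      ← Real.rpow_mul hy0.le, ← Real.rpow_neg hy0.le, ← Real.rpow_add hy0]
    congr 1
    push_cast
    ring
  rw [e, div_pow (d ^ 2)]
  ring

theorem mellin_series_term {a b s ν : ℝ} (ha : 0 < a) (hb : 0 < b)
    (hs : 0 < s) (hsν : s < 2 * ν) (n : ℕ) :
    poch ν n / n.factorial * (((a - b) / 2) ^ 2) ^ n *
        (Real.Gamma s * Real.Gamma (2 * ν + 2 * n - s) / Real.Gamma (2 * ν + 2 * n) *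
          ((a + b) / 2) ^ (s - (2 * ν + 2 * n))) =
      (2 / (a + b)) ^ (2 * ν - s) * betaFn s (2 * ν - s) *
        (poch (ν - s / 2) n * poch (ν - (s - 1) / 2) n / poch (ν + 1 / 2) n *
          (((a - b) / (a + b)) ^ 2) ^ n / n.factorial) := by
  have hν : 0 < ν := by linarith
  have hm : 0 < (a + b) / 2 := by positivity
  have e : ((a + b) / 2) ^ (s - (2 * ν + 2 * n)) =
      (2 / (a + b)) ^ (2 * ν - s) * (((2 / (a + b)) ^ 2) ^ n) := by
    rw [show 2 / (a + b) = ((a + b) / 2)⁻¹ by rw [inv_div], ← Real.rpow_neg_one,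
      ← Real.rpow_natCast _ 2, ← Real.rpow_natCast _ n, ← Real.rpow_mul hm.le,
      ← Real.rpow_mul hm.le, ← Real.rpow_mul hm.le, ← Real.rpow_add hm]
    congr 1
    push_cast
    ring
  have g1 := Gamma_add_two_mul_nat (x := 2 * ν) (by linarith) n
  have g2 := Gamma_add_two_mul_nat (x := 2 * ν - s) (by linarith) n
  rw [show 2 * ν / 2 = ν by ring] at g1
  rw [show (2 * ν - s) / 2 = ν - s / 2 by ring,
    show ν - s / 2 + 1 / 2 = ν - (s - 1) / 2 by ring] at g2
  rw [e, show 2 * ν + 2 * n - s = 2 * ν - s + 2 * n by ring, g1, g2, betaFn,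
    show s + (2 * ν - s) = 2 * ν by ring,
    show (a - b) / (a + b) = (a - b) / 2 * (2 / (a + b)) by field_simp, mul_pow, mul_pow]
  have p1 := (poch_pos hν n).ne'
  have p2 := (poch_pos (c := ν + 1 / 2) (by linarith) n).ne'
  have p3 := (Real.Gamma_pos_of_pos (s := 2 * ν) (by linarith)).ne'
  generalize (2 / (a + b)) ^ (2 * ν - s) = A
  generalize ((2 / (a + b)) ^ 2) ^ n = B
  generalize (((a - b) / 2) ^ 2) ^ n = C
  field_simp

/-- For `a,b > 0` and `0 < s < 2ν`:
`∫₀^∞ x^{s−1}/[(x+a)(x+b)]^ν dx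
  = (2/(a+b))^{2ν−s} B(s,2ν−s) ₂F₁(ν−s/2,ν−(s−1)/2;ν+1/2;((a−b)/(a+b))²)`. -/
theorem mellin_transform_product_linear_sq (a b s ν : ℝ) (ha : 0 < a) (hb : 0 < b)
    (hs : 0 < s) (hsν : s < 2 * ν) :
    ∫ x in Ioi (0:ℝ), x ^ (s - 1) / ((x + a) * (x + b)) ^ ν
      = (2 / (a + b)) ^ (2 * ν - s) * betaFn s (2 * ν - s) *
          hyp2F1 (ν - s / 2) (ν - (s - 1) / 2) (ν + 1 / 2) (((a - b) / (a + b)) ^ 2) := by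
  have hν : 0 < ν := by linarith
  have hm : 0 < (a + b) / 2 := by positivity
  set c : ℕ → ℝ := fun n ↦ poch ν n / n.factorial * (((a - b) / 2) ^ 2) ^ n with hc
  have hc0 (n : ℕ) : 0 ≤ c n := by
    have := poch_pos hν n
    positivity
  have hexp (x : ℝ) (hx : x ∈ Ioi (0 : ℝ)) :
      ENNReal.ofReal (x ^ (s - 1) / ((x + a) * (x + b)) ^ ν) =
        ∑' n : ℕ, ENNReal.ofReal (c n) *
          ENNReal.ofReal (x ^ (s - 1) * (x + (a + b) / 2) ^ (-(2 * ν + 2 * n))) := by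
    have hx : 0 < x := hx
    have h := (hasSum_mul_add_rpow_neg ha hb hx ν).mul_left (x ^ (s - 1))
    rw [div_eq_mul_inv, ← Real.rpow_neg (by positivity), ← h.tsum_eq,
      ENNReal.ofReal_tsum_of_nonneg (fun n ↦ ?_) h.summable]
    · refine tsum_congr fun n ↦ ?_
      rw [← ENNReal.ofReal_mul (hc0 n), mul_left_comm]
    · exact mul_nonneg (by positivity) (mul_nonneg (hc0 n) (by positivity))
  rw [integral_eq_lintegral_of_nonneg_ae, setLIntegral_congr_fun measurableSet_Ioi hexp,
    lintegral_tsum (fun n ↦ by fun_prop)]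
  · simp_rw [lintegral_const_mul' _ _ ENNReal.ofReal_ne_top]
    have hterm (n : ℕ) := lintegral_rpow_mul_add_rpow_neg (p := 2 * ν + 2 * n) hs
      (by have : (0 : ℝ) ≤ n := n.cast_nonneg
          linarith) hm
    simp_rw [hterm, ← ENNReal.ofReal_mul (hc0 _)]
    rw [ENNReal.tsum_toReal_eq fun _ ↦ ENNReal.ofReal_ne_top, hyp2F1, ← tsum_mul_left]
    refine tsum_congr fun n ↦ ?_
    rw [ENNReal.toReal_ofReal, ← mellin_series_term ha hb hs hsν]
    have hn : (0 : ℝ) ≤ n := n.cast_nonneg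
    have h1 := Real.Gamma_pos_of_pos hs
    have h2 := Real.Gamma_pos_of_pos (s := 2 * ν + 2 * n) (by linarith)
    have h3 := Real.Gamma_pos_of_pos (s := 2 * ν + 2 * n - s) (by linarith)
    exact mul_nonneg (hc0 n) (by positivity)
  · filter_upwards [ae_restrict_mem measurableSet_Ioi] with x hx
    have : 0 < x := hx
    simp only [Pi.zero_apply]
    positivity
  · exact Measurable.aestronglyMeasurable (by fun_prop)
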